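/- arXiv:2201.12065 — 3 statements merged into one kernel-verified Lean document; each statement's English description precedes it below -/
import Mathlib

section
/- The zero locus of the set {q_0, q_1, q_2, q_3} in the prime spectrum of the polynomial ring ℂ[a_{0,1}, …, a_{3,2}] in 12 variables is an irreducible (and nonempty) topological space; i.e., the complete intersection Q = V(q_0,q_1,q_2,q_3) ⊆ P^11 is irreducible. -/
/- Variable indices in `Fin 12`:
0:a₀₁ 1:a₀₂ 2:a₀₃ 3:a₁₀ 4:a₁₂ 5:a₁₃ 6:a₂₀ 7:a₂₁ 8:a₂₃ 9:a₃₀ 10:a₃₁ 11:a₃₂ -/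

open MvPolynomial

noncomputable section

abbrev Sa : Type := MvPolynomial (Fin 12) ℂ

def q0 : Sa := X 4 * X 5 - X 7 * X 8 + X 10 * X 11
def q1 : Sa := X 1 * X 2 - X 9 * X 11 + X 6 * X 8
def q2 : Sa := X 3 * X 5 - X 0 * X 2 + X 9 * X 10
def q3 : Sa := X 0 * X 1 - X 3 * X 4 + X 6 * X 7

section NonZeroDivisors

variable {R : Type*} [CommRing R]

/-- `f` is a non-zero-divisor modulo the ideal `J`. -/
def NzdMod (J : Ideal R) (f : R) : Prop := ∀ g, g * f ∈ J → g ∈ J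

namespace NzdMod

variable {J : Ideal R} {f g : R}

theorem mul (hf : NzdMod J f) (hg : NzdMod J g) : NzdMod J (f * g) := fun h hh =>
  hf h (hg (h * f) (by rwa [mul_assoc]))

theorem pow (hf : NzdMod J f) (n : ℕ) : NzdMod J (f ^ n) := by
  induction n with
  | zero => intro h hh; simpa using hh
  | succ n ih => rw [pow_succ]; exact ih.mul hf

theorem neg (hf : NzdMod J f) : NzdMod J (-f) := fun h hh =>
  hf h (by rw [mul_neg] at hh; exact neg_mem_iff.1 hh)

/-- If `x` is regular modulo `G` and `q` is regular modulo `G` and `x`, then `x` is regular modulo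
`G` and `q`. -/
theorem insert {G : Set R} {x q : R} (hx : NzdMod (Ideal.span G) x)
    (hq : NzdMod (Ideal.span (insert x G)) q) : NzdMod (Ideal.span (insert q G)) x := by
  intro f hf
  obtain ⟨d, j, hj, hd⟩ := Ideal.mem_span_insert.1 hf
  have hdx : d ∈ Ideal.span (Insert.insert x G) := by
    apply hq
    rw [Ideal.mem_span_insert]
    exact ⟨f, -j, neg_mem hj, by rw [hd]; ring⟩
  obtain ⟨a, k, hk, rfl⟩ := Ideal.mem_span_insert.1 hdx
  have hfa : f - a * q ∈ Ideal.span G := by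
    apply hx
    have : (f - a * q) * x = q * k + j := by linear_combination hd
    rw [this]
    exact add_mem (Ideal.mul_mem_left _ _ hk) hj
  exact Ideal.mem_span_insert.2 ⟨a, _, hfa, by ring⟩

open DirectSum in
/-- A sum of two homogeneous elements is regular modulo a homogeneous ideal as soon as its
component of larger degree is. -/
theorem add_of_degree_lt {σ : Type*} [SetLike σ R] [AddSubgroupClass σ R] (𝒜 : ℕ → σ)
    [GradedRing 𝒜] (hJ : J.IsHomogeneous 𝒜) {m l : R} {d e : ℕ} (hm : m ∈ 𝒜 d) (hl : l ∈ 𝒜 e)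
    (hed : e < d) (h : NzdMod J m) : NzdMod J (m + l) := by
  have key : ∀ n f, (∀ k, n ≤ k → (decompose 𝒜 f k : R) = 0) → f * (m + l) ∈ J → f ∈ J := by
    intro n
    induction n with
    | zero =>
      intro f hf _
      exact hJ.mem_iff.2 fun i => by rw [hf i (Nat.zero_le i)]; exact zero_mem J
    | succ n ih =>
      intro f hf hfJ
      have hfn : (decompose 𝒜 f n : R) ∈ J := by
        apply h
        have := hJ.mem_iff.1 hfJ (n + d)
        rwa [mul_add, decompose_add, DirectSum.add_apply, AddMemClass.coe_add,
          coe_decompose_mul_of_right_mem_of_le 𝒜 hm (by omega),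
          coe_decompose_mul_of_right_mem_of_le 𝒜 hl (by omega), Nat.add_sub_cancel,
          hf (n + d - e) (by omega), zero_mul, add_zero] at this
      have hsub : f - decompose 𝒜 f n ∈ J := by
        refine ih _ (fun k hk => ?_) ?_
        · rw [decompose_sub, DirectSum.sub_apply, AddSubgroupClass.coe_sub, decompose_coe]
          obtain rfl | hk := hk.eq_or_lt
          · rw [of_eq_same, sub_self]
          · rw [of_eq_of_ne _ _ _ hk.ne', hf k hk, ZeroMemClass.coe_zero, sub_zero]
        · rw [sub_mul]
          exact sub_mem hfJ (Ideal.mul_mem_right _ _ hfn)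
      simpa using add_mem hsub hfn
  intro f hf
  classical
  refine key ((decompose 𝒜 f).support.sup id + 1) f (fun k hk => ?_) hf
  by_contra hne
  have : k ∈ (decompose 𝒜 f).support :=
    DFinsupp.mem_support_iff.2 fun h0 => hne (by rw [h0, ZeroMemClass.coe_zero])
  have := Finset.le_sup (f := id) this
  simp only [id] at this
  omega

theorem singleton {x q : R} (hx : NzdMod (Ideal.span ∅) x) (hq : NzdMod (Ideal.span {x}) q) :
    NzdMod (Ideal.span {q}) x := by
  rw [← insert_empty_eq] at hq ⊢
  exact hx.insert hq

end NzdMod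

end NonZeroDivisors

section FreeVariables

variable {σ R : Type*} [CommRing R]

theorem isWeightedHomogeneous_zero_of_mem_supported {M : Type*} [AddCommMonoid M] {w : σ → M}
    {s : Set σ} (hw : ∀ i ∈ s, w i = 0) {g : MvPolynomial σ R} (hg : g ∈ supported R s) :
    IsWeightedHomogeneous w g 0 := by
  rw [supported_eq_adjoin_X] at hg
  induction hg using Algebra.adjoin_induction with
  | mem x hx =>
    obtain ⟨i, hi, rfl⟩ := hx
    exact hw i hi ▸ isWeightedHomogeneous_X R w i
  | algebraMap r => exact isWeightedHomogeneous_C w r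
  | add x y _ _ hx hy => exact hx.add hy
  | mul x y _ _ hx hy => simpa using hx.mul hy

theorem mul_divMonomial_of_mem_supported {i : σ} {g : MvPolynomial σ R}
    (hg : g ∈ supported R {i}ᶜ) (a : MvPolynomial σ R) :
    (a * g).divMonomial (Finsupp.single i 1) = a.divMonomial (Finsupp.single i 1) * g := by
  rw [supported_eq_adjoin_X] at hg
  induction hg using Algebra.adjoin_induction generalizing a with
  | mem x hx =>
    obtain ⟨j, hj, rfl⟩ := hx
    have hij : i ≠ j := fun h => hj h.symm
    classical
    ext s
    simp only [coeff_divMonomial, coeff_mul_X', Finsupp.mem_support_iff, Finsupp.add_apply,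
      Finsupp.single_eq_of_ne' hij, zero_add]
    split_ifs with hs
    · rw [add_tsub_assoc_of_le]
      exact Finsupp.single_le_iff.2 (Nat.one_le_iff_ne_zero.2 hs)
    · rfl
  | algebraMap r =>
    ext s
    simp only [algebraMap_eq, mul_comm _ (C r), coeff_divMonomial, coeff_C_mul]
  | add x y _ _ hx hy => rw [mul_add, add_divMonomial, hx, hy, mul_add]
  | mul x y _ _ hx hy => rw [← mul_assoc, hy, hx, mul_assoc]

/-- A variable is regular modulo polynomials that do not involve it. -/
theorem nzdMod_X {i : σ} {G : Set (MvPolynomial σ R)} (hG : ∀ g ∈ G, g ∈ supported R {i}ᶜ) :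
    NzdMod (Ideal.span G) (X i) := by
  have key : ∀ f ∈ Ideal.span G, ∀ a, (a * f).divMonomial (Finsupp.single i 1) ∈ Ideal.span G := by
    intro f hf
    induction hf using Submodule.span_induction with
    | mem x hx =>
      intro a
      rw [mul_divMonomial_of_mem_supported (hG x hx)]
      exact Ideal.mul_mem_left _ _ (Ideal.subset_span hx)
    | zero => intro a; rw [mul_zero, zero_divMonomial]; exact zero_mem _
    | add x y _ _ hx hy => intro a; rw [mul_add, add_divMonomial]; exact add_mem (hx a) (hy a)
    | smul b x _ hx => intro a; rw [smul_eq_mul, ← mul_assoc]; exact hx (a * b)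
  intro f hf
  simpa using key _ hf 1

/-- A polynomial `c * X i + e` which is linear in `X i` is regular modulo polynomials that do not
involve `X i` as soon as its leading coefficient `c` is. -/
theorem nzdMod_linear (i : σ) {G : Set (MvPolynomial σ R)} {q : MvPolynomial σ R}
    (c e : MvPolynomial σ R) (hq : q = c * X i + e) (hG : ∀ g ∈ G, g ∈ supported R {i}ᶜ)
    (hc : c ∈ supported R {i}ᶜ) (he : e ∈ supported R {i}ᶜ) (h : NzdMod (Ideal.span G) c) :
    NzdMod (Ideal.span G) q := by
  classical
  let w : σ → ℕ := Pi.single i 1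
  have hw : ∀ j ∈ ({i}ᶜ : Set σ), w j = 0 := fun j hj => Pi.single_eq_of_ne hj 1
  let _ := weightedGradedAlgebra R w
  have hX : IsWeightedHomogeneous w (X i : MvPolynomial σ R) 1 := by
    simpa [w] using isWeightedHomogeneous_X R w i
  rw [hq]
  refine NzdMod.add_of_degree_lt (weightedHomogeneousSubmodule R w)
    (Ideal.homogeneous_span _ _ fun g hg =>
      ⟨0, isWeightedHomogeneous_zero_of_mem_supported hw (hG g hg)⟩)
    ((isWeightedHomogeneous_zero_of_mem_supported hw hc).mul hX)
    (isWeightedHomogeneous_zero_of_mem_supported hw he) zero_lt_one (h.mul (nzdMod_X hG))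

end FreeVariables

section Quadrics

/-- The determinant of the system `q0 = q2 = 0`, which is linear in `X 5` and `X 10`. -/
def linearDet : Sa := X 3 * X 11 - X 4 * X 9

variable {i : Fin 12}

@[simp]
theorem q0_mem_supported (h : i ∉ [4, 5, 7, 8, 10, 11]) : q0 ∈ supported ℂ {i}ᶜ := by
  simp only [List.mem_cons, List.not_mem_nil, or_false, not_or] at h
  apply_rules [add_mem, sub_mem, mul_mem, X_mem_supported.2] <;>
    simp only [Set.mem_compl_iff, Set.mem_singleton_iff] <;> tauto

@[simp]
theorem q1_mem_supported (h : i ∉ [1, 2, 6, 8, 9, 11]) : q1 ∈ supported ℂ {i}ᶜ := by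
  simp only [List.mem_cons, List.not_mem_nil, or_false, not_or] at h
  apply_rules [add_mem, sub_mem, mul_mem, X_mem_supported.2] <;>
    simp only [Set.mem_compl_iff, Set.mem_singleton_iff] <;> tauto

@[simp]
theorem q3_mem_supported (h : i ∉ [0, 1, 3, 4, 6, 7]) : q3 ∈ supported ℂ {i}ᶜ := by
  simp only [List.mem_cons, List.not_mem_nil, or_false, not_or] at h
  apply_rules [add_mem, sub_mem, mul_mem, X_mem_supported.2] <;>
    simp only [Set.mem_compl_iff, Set.mem_singleton_iff] <;> tauto

@[simp]
theorem linearDet_mem_supported (h : i ∉ [3, 4, 9, 11]) : linearDet ∈ supported ℂ {i}ᶜ := by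
  simp only [List.mem_cons, List.not_mem_nil, or_false, not_or] at h
  apply_rules [add_mem, sub_mem, mul_mem, X_mem_supported.2] <;>
    simp only [Set.mem_compl_iff, Set.mem_singleton_iff] <;> tauto

variable {G : Set Sa}

theorem nzdMod_q3_of_X6 (hG : ∀ g ∈ G, g ∈ supported ℂ {7}ᶜ)
    (h : NzdMod (Ideal.span G) (X 6)) : NzdMod (Ideal.span G) q3 := by
  refine nzdMod_linear 7 (X 6) (X 0 * X 1 - X 3 * X 4) (by rw [q3]; ring) hG ?_ ?_ h <;> clear hG h <;>
    apply_rules [add_mem, sub_mem, neg_mem, mul_mem, X_mem_supported.2] <;> simp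

theorem nzdMod_q3_of_X3 (hG : ∀ g ∈ G, g ∈ supported ℂ {4}ᶜ)
    (h : NzdMod (Ideal.span G) (X 3)) : NzdMod (Ideal.span G) q3 := by
  refine nzdMod_linear 4 (-X 3) (X 0 * X 1 + X 6 * X 7) (by rw [q3]; ring) hG ?_ ?_ h.neg <;> clear hG h <;>
    apply_rules [add_mem, sub_mem, neg_mem, mul_mem, X_mem_supported.2] <;> simp

theorem nzdMod_q3_of_X1 (hG : ∀ g ∈ G, g ∈ supported ℂ {0}ᶜ)
    (h : NzdMod (Ideal.span G) (X 1)) : NzdMod (Ideal.span G) q3 := by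
  refine nzdMod_linear 0 (X 1) (X 6 * X 7 - X 3 * X 4) (by rw [q3]; ring) hG ?_ ?_ h <;> clear hG h <;>
    apply_rules [add_mem, sub_mem, neg_mem, mul_mem, X_mem_supported.2] <;> simp

theorem nzdMod_q1_of_X11 (hG : ∀ g ∈ G, g ∈ supported ℂ {9}ᶜ)
    (h : NzdMod (Ideal.span G) (X 11)) : NzdMod (Ideal.span G) q1 := by
  refine nzdMod_linear 9 (-X 11) (X 1 * X 2 + X 6 * X 8) (by rw [q1]; ring) hG ?_ ?_ h.neg <;> clear hG h <;>
    apply_rules [add_mem, sub_mem, neg_mem, mul_mem, X_mem_supported.2] <;> simp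

theorem nzdMod_q1_of_X6 (hG : ∀ g ∈ G, g ∈ supported ℂ {8}ᶜ)
    (h : NzdMod (Ideal.span G) (X 6)) : NzdMod (Ideal.span G) q1 := by
  refine nzdMod_linear 8 (X 6) (X 1 * X 2 - X 9 * X 11) (by rw [q1]; ring) hG ?_ ?_ h <;> clear hG h <;>
    apply_rules [add_mem, sub_mem, neg_mem, mul_mem, X_mem_supported.2] <;> simp

theorem nzdMod_q1_of_X1 (hG : ∀ g ∈ G, g ∈ supported ℂ {2}ᶜ)
    (h : NzdMod (Ideal.span G) (X 1)) : NzdMod (Ideal.span G) q1 := by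
  refine nzdMod_linear 2 (X 1) (X 6 * X 8 - X 9 * X 11) (by rw [q1]; ring) hG ?_ ?_ h <;> clear hG h <;>
    apply_rules [add_mem, sub_mem, neg_mem, mul_mem, X_mem_supported.2] <;> simp

theorem nzdMod_q0_of_X11 (hG : ∀ g ∈ G, g ∈ supported ℂ {10}ᶜ)
    (h : NzdMod (Ideal.span G) (X 11)) : NzdMod (Ideal.span G) q0 := by
  refine nzdMod_linear 10 (X 11) (X 4 * X 5 - X 7 * X 8) (by rw [q0]; ring) hG ?_ ?_ h <;> clear hG h <;>
    apply_rules [add_mem, sub_mem, neg_mem, mul_mem, X_mem_supported.2] <;> simp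

theorem nzdMod_q0_of_X4 (hG : ∀ g ∈ G, g ∈ supported ℂ {5}ᶜ)
    (h : NzdMod (Ideal.span G) (X 4)) : NzdMod (Ideal.span G) q0 := by
  refine nzdMod_linear 5 (X 4) (X 10 * X 11 - X 7 * X 8) (by rw [q0]; ring) hG ?_ ?_ h <;> clear hG h <;>
    apply_rules [add_mem, sub_mem, neg_mem, mul_mem, X_mem_supported.2] <;> simp

theorem nzdMod_linearDet_of_X11 (hG : ∀ g ∈ G, g ∈ supported ℂ {3}ᶜ)
    (h : NzdMod (Ideal.span G) (X 11)) : NzdMod (Ideal.span G) linearDet := by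
  refine nzdMod_linear 3 (X 11) (-(X 4 * X 9)) (by rw [linearDet]; ring) hG ?_ ?_ h <;> clear hG h <;>
    apply_rules [add_mem, sub_mem, neg_mem, mul_mem, X_mem_supported.2] <;> simp

theorem nzdMod_X1_q0_q1_q3 : NzdMod (Ideal.span {q0, q1, q3}) (X 1) := by
  have h3 : NzdMod (Ideal.span {q3}) (X 1) := .singleton (nzdMod_X (by simp)) (nzdMod_q3_of_X6 (by simp) (nzdMod_X (by simp)))
  have h1 : NzdMod (Ideal.span {q1, q3}) (X 1) := h3.insert (nzdMod_q1_of_X11 (by simp) (nzdMod_X (by simp)))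
  refine h1.insert (nzdMod_q0_of_X11 (by simp) ?_)
  rw [Set.insert_comm]
  refine .insert (nzdMod_X (by simp)) (nzdMod_q1_of_X6 (by simp) ?_)
  rw [Set.pair_comm, Set.insert_comm]
  exact .insert (nzdMod_X (by simp)) (nzdMod_q3_of_X3 (by simp) (nzdMod_X (by simp)))

theorem span_X1_q0_q1_q3 : Ideal.span {X 1, q0, q1, q3} =
    Ideal.span {X 1, q0, X 6 * X 8 - X 9 * X 11, X 6 * X 7 - X 3 * X 4} := by
  apply le_antisymm <;> refine Ideal.span_le.2 ?_ <;> rintro g (rfl | rfl | rfl | rfl)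
  · exact Ideal.subset_span (by simp)
  · exact Ideal.subset_span (by simp)
  · rw [show q1 = X 2 * X 1 + (X 6 * X 8 - X 9 * X 11) by rw [q1]; ring]
    exact add_mem (Ideal.mul_mem_left _ _ (Ideal.subset_span (by simp)))
      (Ideal.subset_span (by simp))
  · rw [show q3 = X 0 * X 1 + (X 6 * X 7 - X 3 * X 4) by rw [q3]; ring]
    exact add_mem (Ideal.mul_mem_left _ _ (Ideal.subset_span (by simp)))
      (Ideal.subset_span (by simp))
  · exact Ideal.subset_span (by simp)
  · exact Ideal.subset_span (by simp)
  · rw [show X 6 * X 8 - X 9 * X 11 = q1 - X 2 * X 1 by rw [q1]; ring]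
    exact sub_mem (Ideal.subset_span (by simp))
      (Ideal.mul_mem_left _ _ (Ideal.subset_span (by simp)))
  · rw [show X 6 * X 7 - X 3 * X 4 = q3 - X 0 * X 1 by rw [q3]; ring]
    exact sub_mem (Ideal.subset_span (by simp))
      (Ideal.mul_mem_left _ _ (Ideal.subset_span (by simp)))

theorem nzdMod_X1 : NzdMod (Ideal.span {q2, q0, q1, q3}) (X 1) := by
  refine nzdMod_X1_q0_q1_q3.insert ?_
  have hG : ∀ k ∈ ({0, 2} : Set (Fin 12)),
      ∀ g ∈ ({X 1, q0, X 6 * X 8 - X 9 * X 11, X 6 * X 7 - X 3 * X 4} : Set Sa),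
        g ∈ supported ℂ {k}ᶜ := by
    intro k hk g hg
    refine supported_mono (Set.compl_subset_compl.2 (Set.singleton_subset_iff.2 hk)) ?_
    clear hk
    obtain rfl | rfl | rfl | rfl := hg <;>
      apply_rules [add_mem, sub_mem, mul_mem, X_mem_supported.2] <;> simp
  rw [span_X1_q0_q1_q3]
  refine nzdMod_linear 0 (-X 2) (X 3 * X 5 + X 9 * X 10) (by rw [q2]; ring) (hG 0 (by simp))
    ?_ ?_ (nzdMod_X (hG 2 (by simp))).neg <;> clear hG <;>
    apply_rules [add_mem, neg_mem, mul_mem, X_mem_supported.2] <;> simp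

theorem nzdMod_linearDet_q0_q1_q3 : NzdMod (Ideal.span {q0, q1, q3}) linearDet := by
  have h3 : NzdMod (Ideal.span {q3}) linearDet :=
    .singleton (nzdMod_linearDet_of_X11 (by simp) (nzdMod_X (by simp))) (nzdMod_q3_of_X6 (by simp) (nzdMod_X (by simp)))
  have h1 : NzdMod (Ideal.span {q1, q3}) linearDet := by
    refine h3.insert (nzdMod_q1_of_X6 (by simp) ?_)
    rw [Set.pair_comm]
    exact .insert (nzdMod_X (by simp)) (nzdMod_q3_of_X1 (by simp) (nzdMod_X (by simp)))
  refine h1.insert (nzdMod_q0_of_X4 (by simp) ?_)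
  rw [Set.insert_comm, Set.pair_comm]
  refine .insert (.insert (.singleton (nzdMod_X (by simp)) (nzdMod_linearDet_of_X11 (by simp) (nzdMod_X (by simp))))
    (nzdMod_q3_of_X6 (by simp) (nzdMod_X (by simp)))) (nzdMod_q1_of_X6 (by simp) ?_)
  rw [Set.insert_comm]
  exact .insert (nzdMod_X (by simp)) (nzdMod_q3_of_X1 (by simp) (nzdMod_X (by simp)))

theorem nzdMod_X0 : NzdMod (Ideal.span {q0, q1, q3, linearDet}) (X 0) := by
  have h3 : NzdMod (Ideal.span {q3, linearDet}) (X 0) := .insert (nzdMod_X (by simp)) (nzdMod_q3_of_X6 (by simp) (nzdMod_X (by simp)))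
  have h1 : NzdMod (Ideal.span {q1, q3, linearDet}) (X 0) := by
    refine h3.insert (nzdMod_q1_of_X1 (by simp) ?_)
    rw [Set.insert_comm]
    exact .insert (nzdMod_X (by simp)) (nzdMod_q3_of_X6 (by simp) (nzdMod_X (by simp)))
  refine h1.insert (nzdMod_q0_of_X4 (by simp) ?_)
  rw [Set.insert_comm, Set.insert_comm (X 0), Set.pair_comm]
  refine .insert (.insert (.insert (nzdMod_X (by simp)) (nzdMod_linearDet_of_X11 (by simp) (nzdMod_X (by simp))))
    (nzdMod_q3_of_X6 (by simp) (nzdMod_X (by simp)))) (nzdMod_q1_of_X1 (by simp) ?_)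
  rw [Set.insert_comm]
  exact .insert (nzdMod_X (by simp)) (nzdMod_q3_of_X6 (by simp) (nzdMod_X (by simp)))

theorem nzdMod_X2 : NzdMod (Ideal.span {q0, q1, q3, linearDet}) (X 2) := by
  have h1 : NzdMod (Ideal.span {q1, q3, linearDet}) (X 2) := by
    refine .insert (nzdMod_X (by simp)) (nzdMod_q1_of_X6 (by simp) ?_)
    rw [Set.insert_comm]
    exact .insert (nzdMod_X (by simp)) (nzdMod_q3_of_X1 (by simp) (nzdMod_X (by simp)))
  refine h1.insert (nzdMod_q0_of_X4 (by simp) ?_)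
  rw [Set.insert_comm, Set.insert_comm (X 2), Set.pair_comm]
  refine .insert (.insert (.insert (nzdMod_X (by simp)) (nzdMod_linearDet_of_X11 (by simp) (nzdMod_X (by simp))))
    (nzdMod_q3_of_X6 (by simp) (nzdMod_X (by simp)))) (nzdMod_q1_of_X6 (by simp) ?_)
  rw [Set.insert_comm]
  exact .insert (nzdMod_X (by simp)) (nzdMod_q3_of_X1 (by simp) (nzdMod_X (by simp)))

/-- With respect to the weights chosen here, `q0`, `q1`, `q3` and `linearDet` are homogeneous while
`X 0 * X 2` is the leading form of `q2`. -/
theorem nzdMod_q2 : NzdMod (Ideal.span {q0, q1, q3, linearDet}) q2 := by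
  let w : Fin 12 → ℕ := ![2, 0, 2, 1, 1, 1, 1, 1, 1, 1, 1, 1]
  have hX : ∀ i j, IsWeightedHomogeneous w (X i * X j : Sa) (w i + w j) := fun i j =>
    (isWeightedHomogeneous_X ℂ w i).mul (isWeightedHomogeneous_X ℂ w j)
  let _ := weightedGradedAlgebra ℂ w
  rw [show q2 = -(X 0 * X 2) + (X 3 * X 5 + X 9 * X 10) by rw [q2]; ring]
  refine NzdMod.add_of_degree_lt (weightedHomogeneousSubmodule ℂ w)
    (Ideal.homogeneous_span _ _ ?_) (d := 4) (e := 2) (neg_mem (hX 0 2))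
    (add_mem (hX 3 5) (hX 9 10)) (by norm_num) (nzdMod_X0.mul nzdMod_X2).neg
  rintro g (rfl | rfl | rfl | rfl) <;> refine ⟨2, ?_⟩
  · exact add_mem (sub_mem (hX 4 5) (hX 7 8)) (hX 10 11)
  · exact add_mem (sub_mem (hX 1 2) (hX 9 11)) (hX 6 8)
  · exact add_mem (sub_mem (hX 0 1) (hX 3 4)) (hX 6 7)
  · exact sub_mem (hX 3 11) (hX 4 9)

theorem nzdMod_linearDet : NzdMod (Ideal.span {q2, q0, q1, q3}) linearDet := by
  refine nzdMod_linearDet_q0_q1_q3.insert ?_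
  rw [Set.insert_comm, Set.insert_comm linearDet, Set.pair_comm]
  exact nzdMod_q2

/-- The denominator of the rational parametrization of the zero locus. -/
def denominator : Sa := X 1 ^ 2 * linearDet

theorem nzdMod_denominator : NzdMod (Ideal.span {q0, q1, q2, q3}) denominator := by
  rw [Set.insert_comm q1, Set.insert_comm]
  exact (nzdMod_X1.pow 2).mul nzdMod_linearDet

end Quadrics

section Parametrization

/-- The indices of the variables that serve as parameters on the zero locus. -/
def parameters : Set (Fin 12) := {0, 2, 5, 10}ᶜ

theorem denominator_mem_supported : denominator ∈ supported ℂ parameters := by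
  rw [denominator, sq, linearDet]
  apply_rules [sub_mem, mul_mem, X_mem_supported.2] <;> simp [parameters]

/-- Modulo the quadrics and up to powers of `denominator`, every variable is a polynomial in the
parameters. -/
theorem exists_elimination_X (i : Fin 12) : ∃ p ∈ supported ℂ parameters,
    X i * denominator - p ∈ Ideal.span {q0, q1, q2, q3} := by
  have hq0 : q0 ∈ Ideal.span {q0, q1, q2, q3} := Ideal.subset_span (by simp)
  have hq1 : q1 ∈ Ideal.span {q0, q1, q2, q3} := Ideal.subset_span (by simp)
  have hq2 : q2 ∈ Ideal.span {q0, q1, q2, q3} := Ideal.subset_span (by simp)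
  have hq3 : q3 ∈ Ideal.span {q0, q1, q2, q3} := Ideal.subset_span (by simp)
  by_cases hi : i ∈ parameters
  · exact ⟨X i * denominator, mul_mem (X_mem_supported.2 hi) denominator_mem_supported, by rw [sub_self]; exact zero_mem _⟩
  simp only [parameters, Set.mem_compl_iff, not_not, Set.mem_insert_iff,
    Set.mem_singleton_iff] at hi
  obtain rfl | rfl | rfl | rfl := hi
  · refine ⟨X 1 * linearDet * (X 3 * X 4 - X 6 * X 7), ?_, ?_⟩
    · apply_rules [sub_mem, mul_mem, X_mem_supported.2] <;> simp [parameters]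
    · convert Ideal.mul_mem_left _ (X 1 * linearDet) hq3 using 1
      rw [denominator, q3]; ring
  · refine ⟨X 1 * linearDet * (X 9 * X 11 - X 6 * X 8), ?_, ?_⟩
    · apply_rules [sub_mem, mul_mem, X_mem_supported.2] <;> simp [parameters]
    · convert Ideal.mul_mem_left _ (X 1 * linearDet) hq1 using 1
      rw [denominator, q1]; ring
  · refine ⟨X 11 * (X 3 * X 4 - X 6 * X 7) * (X 9 * X 11 - X 6 * X 8)
      - X 1 * X 1 * X 7 * X 8 * X 9, ?_, ?_⟩
    · apply_rules [sub_mem, mul_mem, X_mem_supported.2] <;> simp [parameters]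
    · convert add_mem (sub_mem (Ideal.mul_mem_left _ (X 1 ^ 2 * X 11) hq2)
        (Ideal.mul_mem_left _ (X 1 ^ 2 * X 9) hq0))
        (add_mem (Ideal.mul_mem_left _ (X 11 * (X 1 * X 2)) hq3)
        (Ideal.mul_mem_left _ (X 11 * (X 3 * X 4 - X 6 * X 7)) hq1)) using 1
      rw [denominator, linearDet, q0, q1, q2, q3]; ring
  · refine ⟨X 1 * X 1 * X 3 * X 7 * X 8
      - X 4 * (X 3 * X 4 - X 6 * X 7) * (X 9 * X 11 - X 6 * X 8), ?_, ?_⟩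
    · apply_rules [sub_mem, mul_mem, X_mem_supported.2] <;> simp [parameters]
    · convert sub_mem (sub_mem (Ideal.mul_mem_left _ (X 1 ^ 2 * X 3) hq0)
        (Ideal.mul_mem_left _ (X 1 ^ 2 * X 4) hq2))
        (add_mem (Ideal.mul_mem_left _ (X 4 * (X 1 * X 2)) hq3)
        (Ideal.mul_mem_left _ (X 4 * (X 3 * X 4 - X 6 * X 7)) hq1)) using 1
      rw [denominator, linearDet, q0, q1, q2, q3]; ring

theorem exists_elimination (f : Sa) : ∃ n : ℕ, ∃ p ∈ supported ℂ parameters,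
    f * denominator ^ n - p ∈ Ideal.span {q0, q1, q2, q3} := by
  induction f using MvPolynomial.induction_on with
  | C r => exact ⟨0, C r, Subalgebra.algebraMap_mem _ r, by simp⟩
  | add f g hf hg =>
    obtain ⟨m, p, hp, hfp⟩ := hf
    obtain ⟨n, r, hr, hgr⟩ := hg
    refine ⟨m + n, p * denominator ^ n + r * denominator ^ m,
      add_mem (mul_mem hp (pow_mem denominator_mem_supported n))
        (mul_mem hr (pow_mem denominator_mem_supported m)), ?_⟩
    convert add_mem (Ideal.mul_mem_right (denominator ^ n) _ hfp)
      (Ideal.mul_mem_right (denominator ^ m) _ hgr) using 1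
    ring
  | mul_X f i hf =>
    obtain ⟨m, p, hp, hfp⟩ := hf
    obtain ⟨r, hr, hir⟩ := exists_elimination_X i
    refine ⟨m + 1, p * r, mul_mem hp hr, ?_⟩
    convert add_mem (Ideal.mul_mem_right (X i * denominator) _ hfp)
      (Ideal.mul_mem_left _ p hir) using 1
    ring

/-- The coordinates of the generic point of the zero locus. -/
def genericCoordinates (i : Fin 12) : FractionRing Sa :=
  let x : Fin 12 → FractionRing Sa := fun j => algebraMap Sa _ (X j)
  let d := x 3 * x 11 - x 4 * x 9
  let y₀ := (x 3 * x 4 - x 6 * x 7) / x 1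
  let y₂ := (x 9 * x 11 - x 6 * x 8) / x 1
  ![y₀, x 1, y₂, x 3, x 4, (x 11 * y₀ * y₂ - x 7 * x 8 * x 9) / d, x 6, x 7, x 8, x 9,
    (x 3 * x 7 * x 8 - x 4 * y₀ * y₂) / d, x 11] i

/-- Evaluation at the generic point of the zero locus. -/
def parametrization : Sa →ₐ[ℂ] FractionRing Sa := aeval genericCoordinates

theorem parametrization_eq_algebraMap {p : Sa} (hp : p ∈ supported ℂ parameters) :
    parametrization p = algebraMap Sa (FractionRing Sa) p := by
  suffices supported ℂ parameters ≤
      AlgHom.equalizer parametrization (Algebra.algHom ℂ Sa (FractionRing Sa)) from this hp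
  refine Algebra.adjoin_le ?_
  rintro _ ⟨i, hi, rfl⟩
  simp only [SetLike.mem_coe, AlgHom.mem_equalizer, parametrization, aeval_X]
  fin_cases i <;> first | rfl | simp [parameters] at hi

theorem quadrics_le_ker_parametrization :
    Ideal.span {q0, q1, q2, q3} ≤ RingHom.ker parametrization := by
  have h1 : algebraMap Sa (FractionRing Sa) (X 1) ≠ 0 := by
    rw [Ne, FaithfulSMul.algebraMap_eq_zero_iff]
    exact X_ne_zero 1
  have hd : algebraMap Sa (FractionRing Sa) (X 3) * algebraMap Sa (FractionRing Sa) (X 11) -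
      algebraMap Sa (FractionRing Sa) (X 4) * algebraMap Sa (FractionRing Sa) (X 9) ≠ 0 := by
    rw [← map_mul, ← map_mul, ← map_sub, Ne, FaithfulSMul.algebraMap_eq_zero_iff]
    intro h
    have := congrArg (eval (![0, 0, 0, 1, 0, 0, 0, 0, 0, 0, 0, 1] : Fin 12 → ℂ)) h
    simp at this
  -- `field_simp` looks for the denominator in this form
  have hd' := hd
  rw [mul_comm (algebraMap Sa (FractionRing Sa) (X 3))] at hd'
  refine Ideal.span_le.2 ?_
  rintro g (rfl | rfl | rfl | rfl) <;>
    simp only [SetLike.mem_coe, RingHom.mem_ker, parametrization, q0, q1, q2, q3, map_add, map_sub,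
      map_mul, aeval_X] <;>
    simp [genericCoordinates] <;> field_simp <;> ring

end Parametrization

/-- The zero locus of `{q0,q1,q2,q3}` in the prime spectrum of
`ℂ[a₀₁,…,a₃₂]` is an irreducible (and nonempty) topological space, i.e. the
complete intersection `Q = V(q0,q1,q2,q3) ⊆ ℙ¹¹` is irreducible. -/
theorem stmt1 : IsIrreducible (PrimeSpectrum.zeroLocus ({q0, q1, q2, q3} : Set Sa)) := by
  have hker : Ideal.span ({q0, q1, q2, q3} : Set Sa) = RingHom.ker parametrization := by
    refine le_antisymm quadrics_le_ker_parametrization fun f hf => ?_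
    obtain ⟨n, p, hp, hfp⟩ := exists_elimination f
    have hφ := quadrics_le_ker_parametrization hfp
    rw [RingHom.mem_ker, map_sub, map_mul, RingHom.mem_ker.1 hf, zero_mul, zero_sub, neg_eq_zero,
      parametrization_eq_algebraMap hp, FaithfulSMul.algebraMap_eq_zero_iff] at hφ
    rw [hφ, sub_zero] at hfp
    exact nzdMod_denominator.pow n f hfp
  have hprime : (RingHom.ker parametrization).IsPrime := RingHom.ker_isPrime _
  rw [← PrimeSpectrum.zeroLocus_span, hker]
  exact (PrimeSpectrum.isIrreducible_zeroLocus_iff_of_radical _ hprime.isRadical).2 hprime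

end
end

section
/- The Krull dimension of the quotient ring ℂ[a_{0,1}, …, a_{3,2}]/(q_0, q_1, q_2, q_3) equals 8; equivalently, the complete intersection Q = V(q_0,q_1,q_2,q_3) ⊆ P^11 has projective dimension 7. -/
/- Variable indices in `Fin 12`:
0:a₀₁ 1:a₀₂ 2:a₀₃ 3:a₁₀ 4:a₁₂ 5:a₁₃ 6:a₂₀ 7:a₂₁ 8:a₂₃ 9:a₃₀ 10:a₃₁ 11:a₃₂ -/

open MvPolynomial

noncomputable section

/-- An algebra generated by finitely many elements, each of whose squares is an affine-linear
combination of the generators, is spanned as a module by the squarefree monomials in them. -/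
theorem Module.Finite.of_sq_eq_affine {B A ι : Type*} [CommRing B] [CommRing A] [Algebra B A]
    [Fintype ι] (x : ι → A) (hadj : Algebra.adjoin B (Set.range x) = ⊤)
    (hsq : ∀ i, ∃ (c : B) (b : ι → B), x i ^ 2 = algebraMap B A c + ∑ j, b j • x j) :
    Module.Finite B A := by
  classical
  set M : Submodule B A :=
    Submodule.span B (Set.range fun s : Finset ι ↦ ∏ i ∈ s, x i)
  have key : ∀ (n : ℕ) (m : ι → ℕ), ∑ i, m i = n → ∏ i, x i ^ m i ∈ M := by
    intro n
    induction n using Nat.strong_induction_on with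
    | _ n ih =>
      intro m hm
      by_cases hle : ∀ i, m i ≤ 1
      · refine Submodule.subset_span ⟨Finset.univ.filter fun i ↦ m i = 1, ?_⟩
        simp only [Finset.prod_filter]
        refine Finset.prod_congr rfl fun i _ ↦ ?_
        have := hle i
        interval_cases m i <;> simp
      · push Not at hle
        obtain ⟨i, hi⟩ := hle
        obtain ⟨m', rfl⟩ : ∃ m' : ι → ℕ, m = m' + Pi.single i 2 := by
          refine ⟨fun j ↦ m j - Pi.single (M := fun _ ↦ ℕ) i 2 j, funext fun j ↦ ?_⟩
          by_cases hj : j = i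
          · subst hj
            simp only [Pi.add_apply, Pi.single_eq_same]
            omega
          · simp [hj]
        have hprod (k : ℕ) (j : ι) :
            ∏ i, x i ^ (m' + Pi.single j k : ι → ℕ) i = x j ^ k * ∏ i, x i ^ m' i := by
          simp only [Pi.add_apply, pow_add, Finset.prod_mul_distrib]
          rw [mul_comm, Finset.prod_eq_single j (fun l _ hl ↦ by simp [hl]) (by simp)]
          simp
        have hsum (k : ℕ) (j : ι) : ∑ i, (m' + Pi.single j k : ι → ℕ) i = ∑ i, m' i + k := by
          simp [Finset.sum_add_distrib]
        rw [hsum] at hm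
        obtain ⟨c, b, hcb⟩ := hsq i
        rw [hprod, hcb, add_mul, Finset.sum_mul, ← Algebra.smul_def]
        refine M.add_mem (M.smul_mem _ (ih _ (by omega) m' rfl)) (M.sum_mem fun j _ ↦ ?_)
        have hj := ih _ (by omega) (m' + Pi.single j 1) (hsum 1 j)
        rw [hprod, pow_one] at hj
        rw [smul_mul_assoc]
        exact M.smul_mem _ hj
  have htop : M = ⊤ := by
    rw [eq_top_iff]
    intro a _
    have ha : a ∈ Algebra.adjoin B (Set.range x) := hadj ▸ Algebra.mem_top
    rw [Algebra.adjoin_range_eq_range_aeval] at ha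
    obtain ⟨p, rfl⟩ := ha
    change aeval x p ∈ M
    rw [aeval_def, eval₂_eq']
    refine M.sum_mem fun d _ ↦ ?_
    rw [← Algebra.smul_def]
    exact M.smul_mem _ (key _ d rfl)
  exact ⟨htop ▸ Submodule.fg_span (Set.finite_range _)⟩

/-- An integral extension of rings does not increase the Krull dimension, even when the
structure map is not injective. -/
theorem ringKrullDim_le_of_algebra_isIntegral (B A : Type*) [CommRing B] [CommRing A]
    [Algebra B A] [Algebra.IsIntegral B A] : ringKrullDim A ≤ ringKrullDim B :=
  Order.krullDim_le_of_strictMono (fun P ↦ PrimeSpectrum.comap (algebraMap B A) P)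
    fun _ _ h ↦ Ideal.IsIntegral.comap_lt_comap h

/-- If a `k`-algebra is generated by `l` and `x`, and each `x i ^ 2` is affine-linear in `x` over
`k[l]`, then its Krull dimension is at most the number of elements of `l`. -/
theorem ringKrullDim_le_card_of_sq_eq_affine {k A κ ι : Type*} [Field k] [CommRing A] [Algebra k A]
    [Fintype κ] [Fintype ι] (l : κ → A) (x : ι → A)
    (hadj : Algebra.adjoin k (Set.range l ∪ Set.range x) = ⊤)
    (hsq : ∀ i, ∃ (c : MvPolynomial κ k) (b : ι → MvPolynomial κ k),
      x i ^ 2 = aeval l c + ∑ j, aeval l (b j) * x j) :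
    ringKrullDim A ≤ Fintype.card κ := by
  let : Algebra (MvPolynomial κ k) A := (aeval l : MvPolynomial κ k →ₐ[k] A).toRingHom.toAlgebra
  have : IsScalarTower k (MvPolynomial κ k) A :=
    .of_algebraMap_eq fun r ↦ ((aeval l : MvPolynomial κ k →ₐ[k] A).commutes r).symm
  have hfin : Module.Finite (MvPolynomial κ k) A := by
    refine .of_sq_eq_affine x ?_ fun i ↦ ?_
    · have hle : Algebra.adjoin k (Set.range l ∪ Set.range x) ≤
          (Algebra.adjoin (MvPolynomial κ k) (Set.range x)).restrictScalars k := by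
        refine Algebra.adjoin_le (Set.union_subset ?_ Algebra.subset_adjoin)
        rintro _ ⟨i, rfl⟩
        have := (Algebra.adjoin (MvPolynomial κ k) (Set.range x)).algebraMap_mem (X i)
        rwa [show algebraMap (MvPolynomial κ k) A (X i) = l i from aeval_X l i] at this
      rw [eq_top_iff]
      intro a _
      exact hle (hadj ▸ Algebra.mem_top)
    · obtain ⟨c, b, h⟩ := hsq i
      exact ⟨c, b, by simpa only [Algebra.smul_def] using! h⟩
  refine (ringKrullDim_le_of_algebra_isIntegral (MvPolynomial κ k) A).trans ?_
  simp

/-- All closed points of affine space over an algebraically closed field have the same height. -/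
theorem MvPolynomial.height_vanishingIdeal_singleton {k σ : Type*} [Field k] [IsAlgClosed k]
    [Finite σ] (x : σ → k) :
    ((vanishingIdeal k {x} : Ideal (MvPolynomial σ k)).height : WithBot ℕ∞) = Nat.card σ := by
  have hdim : ringKrullDim (MvPolynomial σ k) = Nat.card σ := by simp
  have : FiniteRingKrullDim (MvPolynomial σ k) := by
    rw [finiteRingKrullDim_iff_ne_bot_and_top, hdim]
    exact ⟨WithBot.natCast_ne_bot _, fun h ↦ ENat.natCast_ne_top _ (WithBot.coe_injective h)⟩
  obtain ⟨p, hp, hheight⟩ := Ideal.exists_isMaximal_height (R := MvPolynomial σ k)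
  obtain ⟨y, rfl⟩ := (isMaximal_iff_eq_vanishingIdeal_singleton).mp hp
  let t (v : σ → k) : MvPolynomial σ k →ₐ[k] MvPolynomial σ k := aeval fun i ↦ X i + C (v i)
  have ht (v w : σ → k) (hvw : v + w = 0) : (t v).comp (t w) = AlgHom.id k _ := by
    ext1 i
    have : v i + w i = 0 := congrFun hvw i
    simp [t, add_assoc, ← C_add, this]
  let e : MvPolynomial σ k ≃ₐ[k] MvPolynomial σ k :=
    AlgEquiv.ofAlgHom (t (y - x)) (t (x - y)) (ht _ _ (by abel)) (ht _ _ (by abel))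
  have hcomap : (vanishingIdeal k {x} : Ideal (MvPolynomial σ k)).comap e.toRingEquiv =
      vanishingIdeal k {y} := by
    have heval : (aeval x : MvPolynomial σ k →ₐ[k] k).comp (t (y - x)) = aeval y := by
      ext1 i
      simp [t]
    ext p
    rw [Ideal.mem_comap, mem_vanishingIdeal_singleton_iff, mem_vanishingIdeal_singleton_iff,
      ← heval]
    rfl
  rw [← e.toRingEquiv.height_comap, hcomap, hheight, hdim]

theorem ringKrullDim_quotient_quadrics_le :
    ringKrullDim (Sa ⧸ (Ideal.span {q0, q1, q2, q3})) ≤ 8 := by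
  set I : Ideal Sa := Ideal.span {q0, q1, q2, q3}
  let a (i : Fin 12) : Sa ⧸ I := Ideal.Quotient.mk I (X i)
  have h0 : a 4 * a 5 - a 7 * a 8 + a 10 * a 11 = 0 :=
    Ideal.Quotient.eq_zero_iff_mem.mpr (Ideal.subset_span (by simp) : q0 ∈ I)
  have h1 : a 1 * a 2 - a 9 * a 11 + a 6 * a 8 = 0 :=
    Ideal.Quotient.eq_zero_iff_mem.mpr (Ideal.subset_span (by simp) : q1 ∈ I)
  have h2 : a 3 * a 5 - a 0 * a 2 + a 9 * a 10 = 0 :=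
    Ideal.Quotient.eq_zero_iff_mem.mpr (Ideal.subset_span (by simp) : q2 ∈ I)
  have h3 : a 0 * a 1 - a 3 * a 4 + a 6 * a 7 = 0 :=
    Ideal.Quotient.eq_zero_iff_mem.mpr (Ideal.subset_span (by simp) : q3 ∈ I)
  have ha : Algebra.adjoin ℂ (Set.range a) = ⊤ := by
    have : a = Ideal.Quotient.mkₐ ℂ I ∘ X := rfl
    rw [this, Set.range_comp, ← AlgHom.map_adjoin, adjoin_range_X, Algebra.map_top,
      AlgHom.range_eq_top]
    exact Ideal.Quotient.mkₐ_surjective ℂ I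
  let l : Fin 8 → Sa ⧸ I :=
    ![a 5 - a 4, a 3, a 8 - a 6, a 7, a 10 - a 9, a 11, a 1 - a 0, a 2]
  let x : Fin 4 → Sa ⧸ I := ![a 4, a 6, a 9, a 0]
  refine (ringKrullDim_le_card_of_sq_eq_affine (k := ℂ) l x ?_ ?_).trans (by simp)
  · rw [eq_top_iff, ← ha]
    refine Algebra.adjoin_le ?_
    set T := Algebra.adjoin ℂ (Set.range l ∪ Set.range x)
    have hl (i) : l i ∈ T := Algebra.subset_adjoin (.inl ⟨i, rfl⟩)
    have hx (i) : x i ∈ T := Algebra.subset_adjoin (.inr ⟨i, rfl⟩)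
    have hlx (i j) : l i + x j ∈ T := T.add_mem (hl i) (hx j)
    rintro _ ⟨i, rfl⟩
    fin_cases i
    · exact hx 3
    · simpa [l, x] using hlx 6 3
    · exact hl 7
    · exact hl 1
    · exact hx 0
    · simpa [l, x] using hlx 0 0
    · exact hx 1
    · exact hl 3
    · simpa [l, x] using hlx 2 1
    · exact hx 2
    · simpa [l, x] using hlx 4 2
    · exact hl 5
  · intro i
    fin_cases i
    · refine ⟨X 3 * X 2 - X 4 * X 5, ![-X 0, X 3, -X 5, 0], ?_⟩
      simp [Fin.sum_univ_four, l, x]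
      linear_combination h0
    · refine ⟨-(X 6 * X 7), ![0, -X 2, X 5, -X 7], ?_⟩
      simp [Fin.sum_univ_four, l, x]
      linear_combination h1
    · refine ⟨-(X 1 * X 0), ![-X 1, 0, -X 4, X 7], ?_⟩
      simp [Fin.sum_univ_four, l, x]
      linear_combination h2
    · refine ⟨0, ![X 1, -X 3, 0, -X 6], ?_⟩
      simp [Fin.sum_univ_four, l, x]
      linear_combination h3

theorem le_ringKrullDim_quotient_quadrics :
    8 ≤ ringKrullDim (Sa ⧸ (Ideal.span {q0, q1, q2, q3})) := by
  have hmem : ({q0, q1, q2, q3} : Set Sa) ⊆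
      (vanishingIdeal ℂ {(0 : Fin 12 → ℂ)} : Ideal Sa) := by
    rintro q (rfl | rfl | rfl | rfl) <;>
      simp [q0, q1, q2, q3]
  have h := Ideal.height_le_ringKrullDim_quotient_add_encard _ hmem
  rw [height_vanishingIdeal_singleton, Nat.card_fin] at h
  have hcard : ({q0, q1, q2, q3} : Set Sa).encard ≤ 4 := by
    classical
    have := Finset.card_le_four (a := q0) (b := q1) (c := q2) (d := q3)
    have hcoe : ({q0, q1, q2, q3} : Set Sa) = (({q0, q1, q2, q3} : Finset Sa) : Set Sa) := by simp
    rw [hcoe, Set.encard_coe_eq_coe_finsetCard]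
    exact_mod_cast this
  have h12 : (8 : WithBot ℕ∞) + 4 ≤ ringKrullDim (Sa ⧸ (Ideal.span {q0, q1, q2, q3})) + 4 := by
    refine le_trans (le_of_eq (by norm_num)) (h.trans ?_)
    gcongr
    exact WithBot.coe_le_coe.mpr hcard
  exact (ENat.WithBot.add_le_add_natCast_right_iff (c := 4)).mp h12

/-- The Krull dimension of `ℂ[a₀₁,…,a₃₂]/(q0,q1,q2,q3)` equals `8`;
equivalently `Q = V(q0,q1,q2,q3) ⊆ ℙ¹¹` has projective dimension `7`. -/
theorem stmt2 : ringKrullDim (Sa ⧸ (Ideal.span {q0, q1, q2, q3})) = 8 :=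
  le_antisymm ringKrullDim_quotient_quadrics_le le_ringKrullDim_quotient_quadrics

end
end

section
/- For each row of the 4×6 matrix a = [[a_{0,1}, a_{0,2}, 0, a_{0,3}, 0, 0], [a_{1,0}, 0, a_{1,2}, 0, a_{1,3}, 0], [0, a_{2,0}, a_{2,1}, 0, 0, a_{2,3}], [0, 0, 0, a_{3,0}, a_{3,1}, a_{3,2}]], the images of its three nonzero entries in the quotient ring S_Q = ℂ[a_{0,1}, …, a_{3,2}]/(q_0, q_1, q_2, q_3) form a regular sequence; i.e., each of the triples (a_{0,1}, a_{0,2}, a_{0,3}), (a_{1,0}, a_{1,2}, a_{1,3}), (a_{2,0}, a_{2,1}, a_{2,3}), (a_{3,0}, a_{3,1}, a_{3,2}) is a regular sequence in S_Q. -/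
/- Variable indices in `Fin 12`:
0:a₀₁ 1:a₀₂ 2:a₀₃ 3:a₁₀ 4:a₁₂ 5:a₁₃ 6:a₂₀ 7:a₂₁ 8:a₂₃ 9:a₃₀ 10:a₃₁ 11:a₃₂ -/

open MvPolynomial

noncomputable section

abbrev SQ : Type := Sa ⧸ (Ideal.span ({q0, q1, q2, q3} : Set Sa))

/-- The canonical map `S_a → S_Q = S_a/(q0,q1,q2,q3)`. -/
def mkQ : Sa →+* SQ := Ideal.Quotient.mk (Ideal.span ({q0, q1, q2, q3} : Set Sa))

open RingTheory.Sequence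

section HomogeneousRegular

variable {σ R : Type*} [CommRing R]

attribute [local instance] MvPolynomial.gradedAlgebra

/-- If `p` lies in `I + (a ^ n)` for all `n`, where `I` is a homogeneous ideal and `a` is homogeneous
of positive degree, then `p` lies in `I`. -/
lemma mem_of_forall_sub_pow_mul_mem {I : Ideal (MvPolynomial σ R)}
    (hI : I.IsHomogeneous (homogeneousSubmodule σ R)) {a : MvPolynomial σ R} {d : ℕ}
    (hd : 0 < d) (ha : a.IsHomogeneous d) {p : MvPolynomial σ R}
    (h : ∀ n : ℕ, ∃ r, p - a ^ n * r ∈ I) : p ∈ I := by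
  rw [hI.mem_iff]
  intro i
  obtain ⟨r, hr⟩ := h (i + 1)
  have hpow : a ^ (i + 1) ∈ homogeneousSubmodule σ R (d * (i + 1)) := ha.pow (i + 1)
  have hlt : ¬ d * (i + 1) ≤ i := by nlinarith
  have hzero := DirectSum.coe_decompose_mul_of_left_mem_of_not_le
    (𝒜 := homogeneousSubmodule σ R) (b := r) hpow hlt
  have hcomp := hI i hr
  rw [DirectSum.decompose_sub, DirectSum.sub_apply, AddSubgroupClass.coe_sub, hzero,
    sub_zero] at hcomp
  exact hcomp

/-- A weakly regular sequence of homogeneous polynomials of positive degree. -/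
structure IsHomogeneousRegular (l : List (MvPolynomial σ R)) : Prop where
  homogeneous : ∀ f ∈ l, ∃ d, 0 < d ∧ f.IsHomogeneous d
  isWeaklyRegular : IsWeaklyRegular (MvPolynomial σ R) l

lemma isHomogeneous_ofList {l : List (MvPolynomial σ R)}
    (hl : ∀ f ∈ l, ∃ d, 0 < d ∧ f.IsHomogeneous d) :
    (Ideal.ofList l).IsHomogeneous (homogeneousSubmodule σ R) :=
  Ideal.homogeneous_span _ _ fun f hf => by
    obtain ⟨d, -, hd⟩ := hl f hf
    exact ⟨d, hd⟩

namespace IsHomogeneousRegular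

open scoped Pointwise in
lemma perm {l l' : List (MvPolynomial σ R)} (h : IsHomogeneousRegular l) (hp : l.Perm l') :
    IsHomogeneousRegular l' := by
  refine ⟨fun f hf => h.homogeneous f (hp.mem_iff.mpr hf),
    IsWeaklyRegular.prototype_perm h.isWeaklyRegular hp fun a b rs hs hK => ?_⟩
  obtain ⟨d, hd, ha⟩ := h.homogeneous a (hs.subset (by simp))
  have hI : (Ideal.ofList rs).IsHomogeneous (homogeneousSubmodule σ R) :=
    isHomogeneous_ofList fun f hf => h.homogeneous f (hs.subset (by simp [hf]))
  have hdiv : ∀ n : ℕ, ∀ x ∈ Submodule.torsionBy _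
      (MvPolynomial σ R ⧸ (Ideal.ofList rs • ⊤ : Submodule (MvPolynomial σ R) (MvPolynomial σ R))) b,
      ∃ y ∈ Submodule.torsionBy _ _ b, a ^ n • y = x := by
    intro n
    induction n with
    | zero => exact fun x hx => ⟨x, hx, by simp⟩
    | succ n ih =>
      intro x hx
      obtain ⟨y, hy, rfl⟩ := ih x hx
      rw [hK] at hy
      obtain ⟨z, hz, rfl⟩ := (Submodule.mem_smul_pointwise_iff_exists _ _ _).mp hy
      exact ⟨z, hz, by rw [pow_succ, mul_smul]⟩
  refine (Submodule.eq_bot_iff _).mpr fun x hx => ?_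
  obtain ⟨p, rfl⟩ := Submodule.mkQ_surjective _ x
  rw [Submodule.mkQ_apply, Submodule.Quotient.mk_eq_zero, smul_eq_mul, Ideal.mul_top]
  refine mem_of_forall_sub_pow_mul_mem hI hd ha fun n => ?_
  obtain ⟨y, -, hy⟩ := hdiv n _ hx
  obtain ⟨r, rfl⟩ := Submodule.mkQ_surjective _ y
  refine ⟨r, ?_⟩
  rw [Submodule.mkQ_apply, Submodule.mkQ_apply, ← Submodule.Quotient.mk_smul, eq_comm,
    Submodule.Quotient.eq, smul_eq_mul, smul_eq_mul, Ideal.mul_top] at hy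
  exact hy

lemma of_append {l l' : List (MvPolynomial σ R)} (h : IsHomogeneousRegular (l ++ l')) :
    IsHomogeneousRegular l :=
  ⟨fun f hf => h.homogeneous f (by simp [hf]),
    ((isWeaklyRegular_append_iff _ _ _).mp h.isWeaklyRegular).1⟩

/-- In a homogeneous regular sequence, an entry `f` may be replaced by a homogeneous `g` that
divides a power of `f` modulo the other entries. -/
lemma replace {l₁ l₂ : List (MvPolynomial σ R)} {f : MvPolynomial σ R}
    (h : IsHomogeneousRegular (l₁ ++ f :: l₂)) {g : MvPolynomial σ R} {d : ℕ} (hd : 0 < d)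
    (hg : g.IsHomogeneous d) (k : ℕ) (c : MvPolynomial σ R)
    (hmem : f ^ k - c * g ∈ Ideal.ofList (l₁ ++ l₂)) :
    IsHomogeneousRegular (l₁ ++ g :: l₂) := by
  have hp (e : MvPolynomial σ R) : (l₁ ++ e :: l₂).Perm (l₁ ++ l₂ ++ [e]) :=
    List.perm_middle.trans (List.perm_append_singleton e _).symm
  have h' := h.perm (hp f)
  refine IsHomogeneousRegular.perm ⟨?_, ?_⟩ (hp g).symm
  · intro e he
    rcases List.mem_append.mp he with he | he
    · exact h'.homogeneous e (List.mem_append_left _ he)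
    · rw [List.mem_singleton.mp he]
      exact ⟨d, hd, hg⟩
  · have hreg := (isWeaklyRegular_append_iff _ _ _).mp h'.isWeaklyRegular
    refine (isWeaklyRegular_append_iff _ _ _).mpr ⟨hreg.1, ?_⟩
    have hf := ((isWeaklyRegular_singleton_iff _ _).mp hreg.2).pow k
    rw [isWeaklyRegular_singleton_iff]
    rw [isSMulRegular_quotient_iff_mem_of_smul_mem] at hf ⊢
    simp only [smul_eq_mul, Ideal.mul_top] at hf ⊢
    refine fun x hx => hf x ?_
    have : f ^ k * x = x * (f ^ k - c * g) + c * (g * x) := by ring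
    rw [this]
    exact add_mem (Ideal.mul_mem_left _ _ hmem) (Ideal.mul_mem_left _ _ hx)

lemma map_X [Nontrivial R] {l : List σ} (hl : l.Nodup) :
    IsHomogeneousRegular (l.map (X : σ → MvPolynomial σ R)) := by
  refine ⟨?_, ?_⟩
  · simp only [List.mem_map]
    rintro _ ⟨i, -, rfl⟩
    exact ⟨1, one_pos, isHomogeneous_X _ _⟩
  induction l using List.reverseRecOn with
  | nil => exact .nil _ _
  | append_singleton l i ih =>
    rw [List.nodup_append] at hl
    rw [List.map_append, isWeaklyRegular_append_iff]
    refine ⟨ih hl.1, ?_⟩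
    rw [List.map_singleton, isWeaklyRegular_singleton_iff,
      isSMulRegular_quotient_iff_mem_of_smul_mem]
    have himage : Ideal.ofList (l.map (X : σ → MvPolynomial σ R)) =
        Ideal.span (X '' {j | j ∈ l}) := by
      refine congrArg Ideal.span (Set.ext fun f => ?_)
      simp
    simp only [smul_eq_mul, Ideal.mul_top, himage, mem_ideal_span_X_image]
    intro p hp m hm
    obtain ⟨j, hj, hne⟩ := hp (Finsupp.single i 1 + m) (by
      rw [mem_support_iff] at hm ⊢
      rwa [coeff_X_mul])
    refine ⟨j, hj, ?_⟩
    have hij : i ≠ j := fun h => hl.2.2 j hj i (by simp) h.symm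
    simpa [Finsupp.single_apply, hij] using hne

end IsHomogeneousRegular

end HomogeneousRegular

/-- A ring element lies in the ideal generated by a list as soon as it is killed by every ring
homomorphism killing the list. -/
lemma mem_ofList_of_forall.{u} {A : Type u} [CommRing A] {l : List A} {p : A}
    (h : ∀ (B : Type u) [CommRing B] (φ : A →+* B), (∀ f ∈ l, φ f = 0) → φ p = 0) :
    p ∈ Ideal.ofList l :=
  Ideal.Quotient.eq_zero_iff_mem.mp <| h (A ⧸ Ideal.ofList l) (Ideal.Quotient.mk _) fun _ hf =>
    Ideal.Quotient.eq_zero_iff_mem.mpr (Ideal.subset_span hf)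

/-- The four quadrics in a relabelling `s` of the variables, followed by the variables labelling
the first row, form a regular sequence. -/
lemma isHomogeneousRegular_quadrics {s : Fin 12 → Fin 12} (hs : Function.Injective s)
    {x : Fin 12 → Sa} (hx : ∀ i, x i = X (s i)) :
    IsHomogeneousRegular
      [x 4 * x 5 - x 7 * x 8 + x 10 * x 11, x 1 * x 2 - x 9 * x 11 + x 6 * x 8,
        x 3 * x 5 - x 0 * x 2 + x 9 * x 10, x 0 * x 1 - x 3 * x 4 + x 6 * x 7,
        x 0, x 1, x 2] := by
  have hX (i : Fin 12) : (x i).IsHomogeneous 1 := hx i ▸ isHomogeneous_X ℂ (s i)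
  have hXX (i j : Fin 12) : (x i * x j).IsHomogeneous 2 := (hX i).mul (hX j)
  have h₀ : IsHomogeneousRegular (R := ℂ) (([0, 1, 2, 5, 8, 10, 4, 7, 6, 9, 3, 11].map s).map X) :=
    .map_X (List.Nodup.map hs (by decide))
  simp only [List.map_cons, List.map_nil, ← hx] at h₀
  have h₁ := h₀.replace (l₁ := [x 0, x 1, x 2, x 5]) one_pos ((hX 8).sub (hX 6)) 1 1
    (mem_ofList_of_forall fun B _ φ hφ => by
      simp only [List.cons_append, List.nil_append, List.forall_mem_cons, map_sub, map_mul,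
        map_pow, map_one] at hφ ⊢
      grind)
  have h₂ := h₁.replace (l₁ := [x 0, x 1, x 2, x 5, x 8 - x 6]) one_pos
    (((hX 10).sub (hX 9)).sub (hX 11)) 1 1
    (mem_ofList_of_forall fun B _ φ hφ => by
      simp only [List.cons_append, List.nil_append, List.forall_mem_cons, map_sub, map_mul,
        map_pow, map_one] at hφ ⊢
      grind)
  have h₃ := h₂.replace (l₁ := [x 0, x 1, x 2, x 5, x 8 - x 6, x 10 - x 9 - x 11]) one_pos
    ((hX 4).sub (hX 3)) 1 1
    (mem_ofList_of_forall fun B _ φ hφ => by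
      simp only [List.cons_append, List.nil_append, List.forall_mem_cons, map_sub, map_mul,
        map_pow, map_one] at hφ ⊢
      grind)
  have h₄ := h₃.replace (l₁ := [x 0, x 1, x 2, x 5, x 8 - x 6, x 10 - x 9 - x 11, x 4 - x 3])
    one_pos ((hX 7).sub (hX 11)) 1 1
    (mem_ofList_of_forall fun B _ φ hφ => by
      simp only [List.cons_append, List.nil_append, List.forall_mem_cons, map_sub, map_mul,
        map_pow, map_one] at hφ ⊢
      grind)
  have h₅ := h₄.replace
    (l₁ := [x 0, x 1, x 2, x 5, x 8 - x 6, x 10 - x 9 - x 11, x 4 - x 3, x 7 - x 11])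
    two_pos (((hXX 1 2).sub (hXX 9 11)).add (hXX 6 8)) 2 1
    (mem_ofList_of_forall fun B _ φ hφ => by
      simp only [List.cons_append, List.nil_append, List.forall_mem_cons, map_sub, map_mul,
        map_pow, map_add, map_one] at hφ ⊢
      grind)
  have h₆ := h₅.replace
    (l₁ := [x 0, x 1, x 2, x 5, x 8 - x 6, x 10 - x 9 - x 11, x 4 - x 3, x 7 - x 11,
      x 1 * x 2 - x 9 * x 11 + x 6 * x 8])
    two_pos (((hXX 3 5).sub (hXX 0 2)).add (hXX 9 10)) 2 1
    (mem_ofList_of_forall fun B _ φ hφ => by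
      simp only [List.cons_append, List.nil_append, List.forall_mem_cons, map_sub, map_mul,
        map_pow, map_add, map_one] at hφ ⊢
      grind)
  have h₇ := h₆.replace
    (l₁ := [x 0, x 1, x 2, x 5, x 8 - x 6, x 10 - x 9 - x 11, x 4 - x 3, x 7 - x 11,
      x 1 * x 2 - x 9 * x 11 + x 6 * x 8, x 3 * x 5 - x 0 * x 2 + x 9 * x 10])
    two_pos (((hXX 0 1).sub (hXX 3 4)).add (hXX 6 7)) 2 (-1)
    (mem_ofList_of_forall fun B _ φ hφ => by
      simp only [List.cons_append, List.nil_append, List.forall_mem_cons, map_sub, map_mul,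
        map_pow, map_add, map_one, map_neg] at hφ ⊢
      grind)
  have h₈ := h₇.replace
    (l₁ := [x 0, x 1, x 2, x 5, x 8 - x 6, x 10 - x 9 - x 11, x 4 - x 3, x 7 - x 11,
      x 1 * x 2 - x 9 * x 11 + x 6 * x 8, x 3 * x 5 - x 0 * x 2 + x 9 * x 10,
      x 0 * x 1 - x 3 * x 4 + x 6 * x 7])
    two_pos (((hXX 4 5).sub (hXX 7 8)).add (hXX 10 11)) 4 (x 6 ^ 2 + x 6 * x 11 + x 11 ^ 2)
    (mem_ofList_of_forall fun B _ φ hφ => by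
      simp only [List.cons_append, List.nil_append, List.forall_mem_cons, map_sub, map_mul,
        map_pow, map_add] at hφ ⊢
      grind)
  refine (h₈.perm (l' := _ ++ [x 5, x 8 - x 6, x 10 - x 9 - x 11, x 4 - x 3, x 7 - x 11])
    ?_).of_append
  generalize x 4 * x 5 - x 7 * x 8 + x 10 * x 11 = y₀
  generalize x 1 * x 2 - x 9 * x 11 + x 6 * x 8 = y₁
  generalize x 3 * x 5 - x 0 * x 2 + x 9 * x 10 = y₂
  generalize x 0 * x 1 - x 3 * x 4 + x 6 * x 7 = y₃
  exact List.Perm.map ![x 0, x 1, x 2, x 5, x 8 - x 6, x 10 - x 9 - x 11, x 4 - x 3, x 7 - x 11,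
    y₁, y₂, y₃, y₀] (l₁ := [0, 1, 2, 3, 4, 5, 6, 7, 8, 9, 10, 11])
    (l₂ := [11, 8, 9, 10, 0, 1, 2, 3, 4, 5, 6, 7]) (by decide)

lemma constantCoeff_eq_zero_of_mem {f : Sa} (hf : f ∈ Ideal.span ({q0, q1, q2, q3} : Set Sa)) :
    constantCoeff f = 0 := by
  have hle : Ideal.span ({q0, q1, q2, q3} : Set Sa) ≤ RingHom.ker (constantCoeff (R := ℂ)) := by
    rw [Ideal.span_le]
    rintro f (rfl | rfl | rfl | rfl) <;> simp [q0, q1, q2, q3]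
  exact hle hf

/-- Three variables that form, together with the four quadrics, a homogeneous regular sequence
have regular images in the quotient by the quadrics. -/
lemma isRegular_of_isHomogeneousRegular {l : List Sa} (h : IsHomogeneousRegular l)
    {i j k : Fin 12} (hl : l.Perm ([q0, q1, q2, q3] ++ [X i, X j, X k])) :
    IsRegular SQ [mkQ (X i), mkQ (X j), mkQ (X k)] := by
  have hspan : Ideal.ofList [q0, q1, q2, q3] = Ideal.span ({q0, q1, q2, q3} : Set Sa) :=
    congrArg Ideal.span (Set.ext fun f => by simp)
  refine ⟨?_, ?_⟩
  · have hw := ((isWeaklyRegular_append_iff _ _ _).mp (h.perm hl).isWeaklyRegular).2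
    have e := Submodule.quotEquivOfEq (Ideal.ofList [q0, q1, q2, q3] • (⊤ : Submodule Sa Sa))
      (Ideal.span ({q0, q1, q2, q3} : Set Sa)) (by rw [smul_eq_mul, Ideal.mul_top, hspan])
    exact (isWeaklyRegular_map_algebraMap_iff SQ SQ [X i, X j, X k]).mpr
      ((e.isWeaklyRegular_congr _).mp hw)
  · let φ : SQ →+* ℂ := Ideal.Quotient.lift _ constantCoeff fun _ => constantCoeff_eq_zero_of_mem
    have hφ (i : Fin 12) : φ (mkQ (X i)) = 0 :=
      (Ideal.Quotient.lift_mk _ _ _).trans (constantCoeff_X _ i)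
    have hle : Ideal.ofList [mkQ (X i), mkQ (X j), mkQ (X k)] ≤ RingHom.ker φ := by
      refine Ideal.span_le.mpr fun f hf => ?_
      simp only [List.mem_cons, List.not_mem_nil, or_false, Set.mem_ofPred_eq] at hf
      rcases hf with rfl | rfl | rfl <;> exact hφ _
    rw [smul_eq_mul, Ideal.mul_top]
    intro htop
    exact RingHom.ker_ne_top φ (top_le_iff.mp (htop.le.trans hle))

/-- For each row of the 4×6 `a`-matrix, the images of its three nonzero entries
in `S_Q = ℂ[a₀₁,…,a₃₂]/(q0,q1,q2,q3)` form a regular sequence: each of the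
triples `(a₀₁,a₀₂,a₀₃)`, `(a₁₀,a₁₂,a₁₃)`, `(a₂₀,a₂₁,a₂₃)`, `(a₃₀,a₃₁,a₃₂)`
is a regular sequence in `S_Q`. -/
theorem stmt6 :
    RingTheory.Sequence.IsRegular SQ [mkQ (X 0), mkQ (X 1), mkQ (X 2)] ∧
    RingTheory.Sequence.IsRegular SQ [mkQ (X 3), mkQ (X 4), mkQ (X 5)] ∧
    RingTheory.Sequence.IsRegular SQ [mkQ (X 6), mkQ (X 7), mkQ (X 8)] ∧
    RingTheory.Sequence.IsRegular SQ [mkQ (X 9), mkQ (X 10), mkQ (X 11)] := by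
  refine ⟨?_, ?_, ?_, ?_⟩
  · exact isRegular_of_isHomogeneousRegular
      (isHomogeneousRegular_quadrics Function.injective_id fun _ => rfl) (.refl _)
  · refine isRegular_of_isHomogeneousRegular
      (isHomogeneousRegular_quadrics (s := ![3, 5, 4, 0, 2, 1, 10, 9, 11, 7, 6, 8]) (by decide)
        fun _ => rfl)
      ((List.Perm.of_eq ?_).trans <| List.Perm.map ![q0, q1, q2, q3, X 3, X 4, X 5]
        (l₁ := [1, 0, 3, 2, 4, 6, 5]) (l₂ := [0, 1, 2, 3, 4, 5, 6]) (by decide))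
    simp only [q0, q1, q2, q3, List.map_cons, List.map_nil, Matrix.cons_val, List.cons.injEq]
    grind
  · refine isRegular_of_isHomogeneousRegular
      (isHomogeneousRegular_quadrics (s := ![7, 6, 8, 4, 3, 5, 1, 0, 2, 11, 10, 9]) (by decide)
        fun _ => rfl)
      ((List.Perm.of_eq ?_).trans <| List.Perm.map ![q0, q1, q2, q3, X 6, X 7, X 8]
        (l₁ := [2, 1, 0, 3, 5, 4, 6]) (l₂ := [0, 1, 2, 3, 4, 5, 6]) (by decide))
    simp only [q0, q1, q2, q3, List.map_cons, List.map_nil, Matrix.cons_val, List.cons.injEq]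
    grind
  · refine isRegular_of_isHomogeneousRegular
      (isHomogeneousRegular_quadrics (s := ![9, 10, 11, 2, 0, 1, 5, 3, 4, 8, 6, 7]) (by decide)
        fun _ => rfl)
      ((List.Perm.of_eq ?_).trans <| List.Perm.map ![q0, q1, q2, q3, X 9, X 10, X 11]
        (l₁ := [3, 0, 1, 2, 4, 5, 6]) (l₂ := [0, 1, 2, 3, 4, 5, 6]) (by decide))
    simp only [q0, q1, q2, q3, List.map_cons, List.map_nil, Matrix.cons_val, List.cons.injEq]
    grind

end
end
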